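/- Let 0 < b < a - 1 and define F_{a,b}(x) = x^{a-b-1}/(ψ(x+a) - ψ(x+b)) for x > 0, where ψ = (log Γ)' is the digamma function. Then F_{a,b} belongs to the generalized Bernstein class B_{a-b}, i.e. the function x ↦ x^{1-(a-b)} F_{a,b}'(x) is completely monotonic on (0,∞). -/

import Mathlib

open Real Set

/-- `f` is completely monotonic on `(0,∞)`. -/
def CompletelyMonotonicOn (f : ℝ → ℝ) : Prop :=
  ContDiffOn ℝ (⊤ : ℕ∞) f (Set.Ioi 0) ∧
  ∀ (n : ℕ) (x : ℝ), 0 < x → 0 ≤ (-1 : ℝ) ^ n * iteratedDeriv n f x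

/-- The digamma function `ψ = (log Γ)'`. -/
noncomputable def digamma : ℝ → ℝ :=
  deriv (fun y : ℝ => Real.log (Real.Gamma y))

/-- `F_{a,b}(x) = x^{a-b-1}/(ψ(x+a) - ψ(x+b))`. -/
noncomputable def F (a b : ℝ) (x : ℝ) : ℝ :=
  x ^ (a - b - 1) / (digamma (x + a) - digamma (x + b))

section ForwardDifference

open Filter Topology

lemma exists_fwdDiff_iter_eq_pow_mul_iteratedDeriv {f : ℝ → ℝ}
    (hf : ContDiffOn ℝ (⊤ : ℕ∞) f (Ioi 0)) (n : ℕ) {x δ : ℝ} (hx : 0 < x) (hδ : 0 < δ) :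
    ∃ ξ ∈ Icc x (x + n * δ), (fwdDiff δ)^[n] f x = δ ^ n * iteratedDeriv n f ξ := by
  induction n generalizing f with
  | zero => exact ⟨x, by simp, by simp⟩
  | succ n ih =>
    have hshift : ContDiffOn ℝ (⊤ : ℕ∞) (fun y => f (y + δ)) (Ioi 0) :=
      hf.comp (by fun_prop) fun y (hy : 0 < y) => show 0 < y + δ by positivity
    obtain ⟨ξ, hξ, h⟩ := ih (f := fwdDiff δ f) (hshift.sub hf)
    have hξ0 : 0 < ξ := hx.trans_le hξ.1
    have hderiv : iteratedDeriv n (fwdDiff δ f) ξ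
        = iteratedDeriv n f (ξ + δ) - iteratedDeriv n f ξ := by
      have h1 : fwdDiff δ f = fun y => f (y + δ) - f y := rfl
      rw [h1, iteratedDeriv_fun_sub, iteratedDeriv_comp_add_const]
      · exact (hshift.contDiffAt (Ioi_mem_nhds hξ0)).of_le (mod_cast le_top)
      · exact (hf.contDiffAt (Ioi_mem_nhds hξ0)).of_le (mod_cast le_top)
    have hd : DifferentiableOn ℝ (iteratedDeriv n f) (Ioi 0) :=
      (hf.differentiableOn_iteratedDerivWithin (m := n) (mod_cast WithTop.coe_lt_top n)
        (uniqueDiffOn_Ioi 0)).congr fun y hy => (iteratedDerivWithin_of_isOpen isOpen_Ioi hy).symm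
    have hd' : DifferentiableOn ℝ (iteratedDeriv n f) (Icc ξ (ξ + δ)) :=
      hd.mono fun y hy => hξ0.trans_le hy.1
    obtain ⟨η, hη, hs⟩ := exists_deriv_eq_slope (iteratedDeriv n f) (lt_add_of_pos_right ξ hδ)
      hd'.continuousOn (hd'.mono Ioo_subset_Icc_self)
    refine ⟨η, ⟨hξ.1.trans hη.1.le, ?_⟩, ?_⟩
    · push_cast
      linarith [hη.2, hξ.2]
    · rw [Function.iterate_succ_apply, h, hderiv, iteratedDeriv_succ, hs, add_sub_cancel_left]
      field_simp
      ring

lemma iteratedDeriv_nonneg_of_fwdDiff_iter {f : ℝ → ℝ}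
    (hf : ContDiffOn ℝ (⊤ : ℕ∞) f (Ioi 0)) (n : ℕ) {s x : ℝ} (hx : 0 < x)
    (h : ∀ δ, 0 < δ → 0 ≤ s * (fwdDiff δ)^[n] f x) : 0 ≤ s * iteratedDeriv n f x := by
  have hc : ContinuousOn (iteratedDeriv n f) (Ioi 0) :=
    (hf.continuousOn_iteratedDerivWithin (m := n) (mod_cast le_top)
      (uniqueDiffOn_Ioi 0)).congr fun y hy => (iteratedDerivWithin_of_isOpen isOpen_Ioi hy).symm
  have hcx : ContinuousAt (iteratedDeriv n f) x := hc.continuousAt (Ioi_mem_nhds hx)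
  have hex : ∀ δ : ℝ, ∃ ξ, 0 < δ → ξ ∈ Icc x (x + n * δ) ∧ 0 ≤ s * iteratedDeriv n f ξ := by
    intro δ
    by_cases hδ : 0 < δ
    · obtain ⟨ξ, hξ, he⟩ := exists_fwdDiff_iter_eq_pow_mul_iteratedDeriv hf n hx hδ
      refine ⟨ξ, fun _ => ⟨hξ, ?_⟩⟩
      have h1 := h δ hδ
      rw [he, mul_left_comm] at h1
      exact nonneg_of_mul_nonneg_right h1 (pow_pos hδ n)
    · exact ⟨0, fun h0 => absurd h0 hδ⟩
  choose ξ hξ using hex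
  have hlim : Tendsto (fun δ : ℝ => x + n * δ) (𝓝[>] 0) (𝓝 x) := by
    have : Tendsto (fun δ : ℝ => x + n * δ) (𝓝 0) (𝓝 (x + n * 0)) :=
      Continuous.tendsto (by fun_prop) 0
    simpa using this.mono_left nhdsWithin_le_nhds
  have hξx : Tendsto ξ (𝓝[>] 0) (𝓝 x) :=
    tendsto_of_tendsto_of_tendsto_of_le_of_le' tendsto_const_nhds hlim
      (by filter_upwards [self_mem_nhdsWithin] with δ hδ using ((hξ δ hδ).1).1)
      (by filter_upwards [self_mem_nhdsWithin] with δ hδ using ((hξ δ hδ).1).2)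
  refine ge_of_tendsto ((hcx.tendsto.comp hξx).const_mul s) ?_
  filter_upwards [self_mem_nhdsWithin] with δ hδ using (hξ δ hδ).2

lemma tendsto_fwdDiff_iter {ι : Type*} {l : Filter ι} {f : ι → ℝ → ℝ} {g : ℝ → ℝ}
    (h : ∀ x, 0 < x → Tendsto (fun i => f i x) l (𝓝 (g x))) (n : ℕ) {x δ : ℝ} (hx : 0 < x)
    (hδ : 0 < δ) : Tendsto (fun i => (fwdDiff δ)^[n] (f i) x) l (𝓝 ((fwdDiff δ)^[n] g x)) := by
  simp only [fwdDiff_iter_eq_sum_shift]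
  exact tendsto_finsetSum _ fun k _ => (h _ (by positivity)).const_smul _

lemma fwdDiff_iter_congr {f g : ℝ → ℝ} (h : ∀ x, 0 < x → f x = g x) (n : ℕ) {x δ : ℝ}
    (hx : 0 < x) (hδ : 0 < δ) : (fwdDiff δ)^[n] f x = (fwdDiff δ)^[n] g x := by
  simp only [fwdDiff_iter_eq_sum_shift]
  exact Finset.sum_congr rfl fun k _ => by rw [h _ (by positivity)]

lemma fwdDiff_iter_const_mul (c : ℝ) (f : ℝ → ℝ) (n : ℕ) (x δ : ℝ) :
    (fwdDiff δ)^[n] (fun y => c * f y) x = c * (fwdDiff δ)^[n] f x :=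
  congrFun (fwdDiff_iter_const_smul δ c f n) x

lemma fwdDiff_iter_tsum_exp_nonneg {p : ℕ → ℝ} {h : ℝ} (hh : 0 < h) (hp : ∀ m, 0 ≤ p m)
    (hs : ∀ x, 0 < x → Summable fun m => p m * rexp (-(h * x)) ^ m) (n : ℕ) {x δ : ℝ}
    (hx : 0 < x) (hδ : 0 < δ) :
    0 ≤ (-1) ^ n * (fwdDiff δ)^[n] (fun y => ∑' m, p m * rexp (-(h * y)) ^ m) x := by
  induction n generalizing p with
  | zero => simpa using tsum_nonneg fun m => mul_nonneg (hp m) (by positivity)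
  | succ n ih =>
    have hexp : ∀ (y : ℝ) (m : ℕ), p m * rexp (-(h * (y + δ))) ^ m
        = p m * rexp (-(h * δ)) ^ m * rexp (-(h * y)) ^ m := by
      intro y m
      rw [mul_assoc, ← mul_pow, ← Real.exp_add]
      ring_nf
    have hs1 : ∀ y, 0 < y → Summable fun m => p m * (1 - rexp (-(h * δ)) ^ m)
        * rexp (-(h * y)) ^ m := fun y hy =>
      ((hs y hy).sub (hs (y + δ) (by positivity))).congr fun m => by rw [hexp]; ring
    have key := ih (p := fun m => p m * (1 - rexp (-(h * δ)) ^ m))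
      (fun m => mul_nonneg (hp m) (sub_nonneg.2 (pow_le_one₀ (by positivity)
        (Real.exp_le_one_iff.2 (by nlinarith))))) hs1
    have hcongr : (fwdDiff δ)^[n] (fwdDiff δ fun y => ∑' m, p m * rexp (-(h * y)) ^ m) x
        = (fwdDiff δ)^[n] (fun y => (-1) * ∑' m, p m * (1 - rexp (-(h * δ)) ^ m)
          * rexp (-(h * y)) ^ m) x := by
      refine fwdDiff_iter_congr (fun y hy => ?_) n hx hδ
      rw [fwdDiff, ← (hs (y + δ) (by positivity)).tsum_sub (hs y hy), ← tsum_mul_left]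
      exact tsum_congr fun m => by rw [hexp]; ring
    rw [Function.iterate_succ_apply, hcongr, fwdDiff_iter_const_mul, pow_succ]
    linarith

end ForwardDifference

section Kaluza

open Filter Topology

lemma exists_convolution_inverse {u : ℕ → ℝ} (h0 : u 0 ≠ 0) :
    ∃ g : ℕ → ℝ, ∀ n, ∑ k ∈ Finset.range (n + 1), g k * u (n - k) = if n = 0 then 1 else 0 := by
  refine ⟨fun n => PowerSeries.coeff n (PowerSeries.mk u)⁻¹, fun n => ?_⟩
  have h := congrArg (PowerSeries.coeff n)
    (PowerSeries.inv_mul_cancel (PowerSeries.mk u) (by simpa using h0))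
  rw [PowerSeries.coeff_mul, Finset.Nat.sum_antidiagonal_eq_sum_range_succ_mk] at h
  simpa [PowerSeries.coeff_one] using h

lemma mul_le_mul_of_logConvex {u : ℕ → ℝ} (hu : ∀ n, 0 < u n)
    (hlc : ∀ n, u (n + 1) ^ 2 ≤ u n * u (n + 2)) {j n : ℕ} (hjn : j ≤ n) :
    u (j + 1) * u n ≤ u (n + 1) * u j := by
  have hmono : Monotone fun n => u (n + 1) / u n := by
    refine monotone_nat_of_le_succ fun n => ?_
    rw [div_le_div_iff₀ (hu _) (hu _)]
    nlinarith [hlc n]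
  have := hmono hjn
  simp only at this
  rwa [div_le_div_iff₀ (hu _) (hu _)] at this

/-- Kaluza's theorem: the convolution inverse of a log-convex sequence has nonpositive
coefficients of positive index. -/
lemma convolution_inverse_nonpos {u g : ℕ → ℝ} (hu : ∀ n, 0 < u n)
    (hlc : ∀ n, u (n + 1) ^ 2 ≤ u n * u (n + 2))
    (hg : ∀ n, ∑ k ∈ Finset.range (n + 1), g k * u (n - k) = if n = 0 then 1 else 0) (n : ℕ) :
    g (n + 1) ≤ 0 := by
  have hg0 : 0 < g 0 := by
    have := hg 0
    simp only [zero_add, Finset.range_one, Finset.sum_singleton, le_refl, tsub_eq_zero_of_le,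
      if_true] at this
    exact pos_of_mul_pos_left (this ▸ one_pos) (hu 0).le
  induction n using Nat.strong_induction_on with
  | _ n ih =>
    have h1 := hg (n + 1)
    rw [Finset.sum_range_succ, Finset.sum_range_succ'] at h1
    simp only [Nat.add_sub_add_right, tsub_zero, tsub_self, Nat.succ_ne_zero, if_false] at h1
    have h2 := hg n
    rw [Finset.sum_range_succ'] at h2
    simp only [tsub_zero] at h2
    rcases Nat.eq_zero_or_pos n with rfl | hn
    · simp only [Finset.range_zero, Finset.sum_empty, zero_add] at h1
      have := mul_pos hg0 (hu 1)
      by_contra! hc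
      have := mul_pos hc (hu 0)
      simp only [zero_add] at *
      linarith
    · rw [if_neg hn.ne'] at h2
      have h3 : u (n + 1) * ∑ k ∈ Finset.range n, g (k + 1) * u (n - (k + 1))
          ≤ u n * ∑ k ∈ Finset.range n, g (k + 1) * u (n - k) := by
        rw [Finset.mul_sum, Finset.mul_sum]
        refine Finset.sum_le_sum fun k hk => ?_
        have hk' := Finset.mem_range.1 hk
        have := mul_le_mul_of_logConvex hu hlc (show n - (k + 1) ≤ n by omega)
        rw [show n - (k + 1) + 1 = n - k by omega] at this
        nlinarith [ih k hk']
      by_contra! hc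
      have h4 := mul_pos (mul_pos hc (hu 0)) (hu n)
      have h5 : u (n + 1) * ∑ k ∈ Finset.range n, g (k + 1) * u (n - (k + 1))
          = - (u (n + 1) * (g 0 * u n)) := by linear_combination u (n + 1) * h2
      have h6 : u n * ∑ k ∈ Finset.range n, g (k + 1) * u (n - k)
          = - (u n * (g 0 * u (n + 1))) - g (n + 1) * u 0 * u n := by
        linear_combination u n * h1
      rw [h5, h6] at h3
      linarith

lemma abs_convolution_inverse_le {u g : ℕ → ℝ} (hu : ∀ n, 0 < u n)
    (hlc : ∀ n, u (n + 1) ^ 2 ≤ u n * u (n + 2))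
    (hg : ∀ n, ∑ k ∈ Finset.range (n + 1), g k * u (n - k) = if n = 0 then 1 else 0) (n : ℕ) :
    |g n| ≤ u n / u 0 ^ 2 := by
  have hnonpos := convolution_inverse_nonpos hu hlc hg
  have hg0 : g 0 * u 0 = 1 := by simpa using hg 0
  have hu0 := hu 0
  rw [le_div_iff₀ (by positivity)]
  cases n with
  | zero =>
    have : 0 < g 0 := pos_of_mul_pos_left (hg0 ▸ one_pos) hu0.le
    rw [abs_of_pos this, sq, ← mul_assoc, hg0, one_mul]
  | succ n =>
    have h1 := hg (n + 1)
    rw [Finset.sum_range_succ, Finset.sum_range_succ'] at h1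
    simp only [Nat.add_sub_add_right, tsub_zero, tsub_self, Nat.succ_ne_zero, if_false] at h1
    have h2 : ∑ k ∈ Finset.range n, g (k + 1) * u (n - k) ≤ 0 :=
      Finset.sum_nonpos fun k _ => mul_nonpos_of_nonpos_of_nonneg (hnonpos k) (hu _).le
    rw [abs_of_nonpos (hnonpos n)]
    have h3 : -g (n + 1) * u 0 ≤ g 0 * u (n + 1) := by linarith
    calc -g (n + 1) * u 0 ^ 2 = (-g (n + 1) * u 0) * u 0 := by ring
      _ ≤ (g 0 * u (n + 1)) * u 0 := by gcongr
      _ = u (n + 1) := by linear_combination u (n + 1) * hg0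

lemma summable_abs_convolution_inverse {u g : ℕ → ℝ} (hu : ∀ n, 0 < u n)
    (hlc : ∀ n, u (n + 1) ^ 2 ≤ u n * u (n + 2))
    (hg : ∀ n, ∑ k ∈ Finset.range (n + 1), g k * u (n - k) = if n = 0 then 1 else 0)
    {z : ℝ} (hz : 0 < z) (hs : Summable fun n => u n * z ^ n) :
    Summable fun n => ‖g n * z ^ n‖ := by
  refine (hs.div_const (u 0 ^ 2)).of_nonneg_of_le (fun _ => norm_nonneg _) fun n => ?_
  rw [norm_mul, Real.norm_eq_abs, Real.norm_of_nonneg (pow_nonneg hz.le n), mul_div_right_comm]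
  gcongr
  exact abs_convolution_inverse_le hu hlc hg n

lemma tsum_convolution_inverse_mul {u g : ℕ → ℝ} (hu : ∀ n, 0 < u n)
    (hlc : ∀ n, u (n + 1) ^ 2 ≤ u n * u (n + 2))
    (hg : ∀ n, ∑ k ∈ Finset.range (n + 1), g k * u (n - k) = if n = 0 then 1 else 0)
    {z : ℝ} (hz : 0 < z) (hs : Summable fun n => u n * z ^ n) :
    (∑' n, g n * z ^ n) * ∑' n, u n * z ^ n = 1 := by
  rw [tsum_mul_tsum_eq_tsum_sum_range_of_summable_norm
    (summable_abs_convolution_inverse hu hlc hg hz hs) hs.norm, tsum_eq_single 0]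
  · simpa using hg 0
  · intro n hn
    have h := hg n
    rw [if_neg hn] at h
    rw [← zero_mul (z ^ n), ← h, Finset.sum_mul]
    refine Finset.sum_congr rfl fun k hk => ?_
    rw [← pow_mul_pow_sub z (Nat.lt_succ_iff.1 (Finset.mem_range.1 hk))]
    ring

lemma sum_range_convolution_inverse_nonneg {u g : ℕ → ℝ} (hu : ∀ n, 0 < u n)
    (hlc : ∀ n, u (n + 1) ^ 2 ≤ u n * u (n + 2))
    (hg : ∀ n, ∑ k ∈ Finset.range (n + 1), g k * u (n - k) = if n = 0 then 1 else 0)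
    (hs : ∀ z, 0 < z → z < 1 → Summable fun n => u n * z ^ n) (m : ℕ) :
    0 ≤ ∑ k ∈ Finset.range (m + 1), g k := by
  have hlim : Tendsto (fun z : ℝ => ∑ k ∈ Finset.range (m + 1), g k * z ^ k) (𝓝[<] 1)
      (𝓝 (∑ k ∈ Finset.range (m + 1), g k)) := by
    have : Tendsto (fun z : ℝ => ∑ k ∈ Finset.range (m + 1), g k * z ^ k) (𝓝 1)
      (𝓝 (∑ k ∈ Finset.range (m + 1), g k * 1 ^ k)) := Continuous.tendsto (by fun_prop) 1
    simpa using this.mono_left nhdsWithin_le_nhds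
  refine ge_of_tendsto hlim ?_
  filter_upwards [Ioo_mem_nhdsLT (zero_lt_one' ℝ)] with z hz
  have hsum := (summable_abs_convolution_inverse hu hlc hg hz.1 (hs z hz.1 hz.2)).of_norm
  have hpos : 0 < ∑' n, g n * z ^ n := by
    have hU : 0 ≤ ∑' n, u n * z ^ n :=
      tsum_nonneg fun n => mul_nonneg (hu n).le (pow_nonneg hz.1.le n)
    exact pos_of_mul_pos_left
      (tsum_convolution_inverse_mul hu hlc hg hz.1 (hs z hz.1 hz.2) ▸ one_pos) hU
  have htail : ∑' n, g (n + (m + 1)) * z ^ (n + (m + 1)) ≤ 0 := tsum_nonpos fun n =>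
    mul_nonpos_of_nonpos_of_nonneg (convolution_inverse_nonpos hu hlc hg (n + m))
      (pow_nonneg hz.1.le _)
  have := hsum.sum_add_tsum_nat_add (m + 1)
  linarith

lemma hasSum_sum_range_mul_pow {g : ℕ → ℝ} {z : ℝ} (hz : 0 < z) (hz1 : z < 1)
    (hs : Summable fun n => ‖g n * z ^ n‖) :
    HasSum (fun m => (∑ k ∈ Finset.range (m + 1), g k) * z ^ m)
      ((∑' n, g n * z ^ n) * (1 - z)⁻¹) := by
  have hgeo : Summable fun n : ℕ => ‖z ^ n‖ := (summable_geometric_of_lt_one hz.le hz1).norm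
  have h := hasSum_sum_range_mul_of_summable_norm hs hgeo
  rw [tsum_geometric_of_lt_one hz.le hz1] at h
  refine (funext fun m => ?_ : (fun m => (∑ k ∈ Finset.range (m + 1), g k) * z ^ m) = _) ▸ h
  rw [Finset.sum_mul]
  refine Finset.sum_congr rfl fun k hk => ?_
  rw [← pow_mul_pow_sub z (Nat.lt_succ_iff.1 (Finset.mem_range.1 hk))]
  ring

end Kaluza
section LogConvexKernel

open Filter Topology

lemma tendsto_div_one_sub_exp_neg {s : ℝ} (hs : 0 < s) :
    Tendsto (fun h : ℝ => h / (1 - rexp (-(h * s)))) (𝓝[>] 0) (𝓝 (1 / s)) := by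
  have hd : HasDerivAt (fun h : ℝ => 1 - rexp (-(h * s))) s 0 := by
    have := (((hasDerivAt_id (0 : ℝ)).mul_const s).neg.exp).const_sub 1
    simpa using this
  have h1 := (hd.tendsto_slope_zero_right).inv₀ hs.ne'
  simpa [div_eq_mul_inv, mul_comm] using h1

variable {u : ℝ → ℕ → ℝ} {D : ℝ → ℝ}

lemma summable_mul_pow_of_summable_exp {v : ℕ → ℝ} {h : ℝ} (hh : 0 < h)
    (hs : ∀ x, 0 < x → Summable fun n => v n * rexp (-(h * x)) ^ n) {z : ℝ} (hz : 0 < z)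
    (hz1 : z < 1) : Summable fun n => v n * z ^ n := by
  have := hs (-Real.log z / h) (div_pos (neg_pos.2 (Real.log_neg hz hz1)) hh)
  rwa [mul_div_cancel₀ _ hh.ne', neg_neg, Real.exp_log hz] at this

lemma fwdDiff_iter_tsum_convolution_inverse_nonneg {v g : ℕ → ℝ} {h : ℝ} (hh : 0 < h)
    (hv : ∀ n, 0 < v n) (hlc : ∀ n, v (n + 1) ^ 2 ≤ v n * v (n + 2))
    (hg : ∀ n, ∑ k ∈ Finset.range (n + 1), g k * v (n - k) = if n = 0 then 1 else 0)
    (hs : ∀ x, 0 < x → Summable fun n => v n * rexp (-(h * x)) ^ n) (n : ℕ) {x δ : ℝ}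
    (hx : 0 < x) (hδ : 0 < δ) :
    0 ≤ (-1) ^ n * (fwdDiff δ)^[n + 1] (fun y => ∑' m, g m * rexp (-(h * y)) ^ m) x := by
  set p : ℕ → ℝ := fun m => (if m = 0 then g 0 else 0) - g m with hp
  have hsg : ∀ y, 0 < y → Summable fun m => g m * rexp (-(h * y)) ^ m := fun y hy =>
    (summable_abs_convolution_inverse hv hlc hg (Real.exp_pos _) (hs y hy)).of_norm
  have hsingle : ∀ y, HasSum (fun m => (if m = 0 then g 0 else 0) * rexp (-(h * y)) ^ m) (g 0) := by
    intro y
    convert hasSum_single (f := fun m => (if m = 0 then g 0 else 0) * rexp (-(h * y)) ^ m) 0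
      (fun m hm => by simp [hm]) using 1
    simp
  have hsp : ∀ y, 0 < y → HasSum (fun m => p m * rexp (-(h * y)) ^ m)
      (g 0 - ∑' m, g m * rexp (-(h * y)) ^ m) := fun y hy => by
    simpa only [hp, sub_mul] using (hsingle y).sub (hsg y hy).hasSum
  have hp0 : ∀ m, 0 ≤ p m := by
    intro m
    cases m with
    | zero => simp [hp]
    | succ m => simpa [hp] using convolution_inverse_nonpos hv hlc hg m
  have key := fwdDiff_iter_tsum_exp_nonneg hh hp0 (fun y hy => (hsp y hy).summable) (n + 1) hx hδ
  rw [Function.iterate_succ_apply] at key ⊢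
  have hcongr : (fwdDiff δ)^[n] (fwdDiff δ fun y => ∑' m, g m * rexp (-(h * y)) ^ m) x
      = (fwdDiff δ)^[n]
        (fun y => (-1) * fwdDiff δ (fun y => ∑' m, p m * rexp (-(h * y)) ^ m) y) x := by
    refine fwdDiff_iter_congr (fun y hy => ?_) n hx hδ
    simp only [fwdDiff]
    rw [(hsp y hy).tsum_eq, (hsp (y + δ) (by positivity)).tsum_eq]
    ring
  rw [hcongr, fwdDiff_iter_const_mul]
  rw [pow_succ] at key
  linarith

lemma fwdDiff_iter_inv_nonneg (hu : ∀ h, 0 < h → ∀ n, 0 < u h n)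
    (hlc : ∀ h, 0 < h → ∀ n, u h (n + 1) ^ 2 ≤ u h n * u h (n + 2))
    (hs : ∀ h, 0 < h → ∀ x, 0 < x → Summable fun n => u h n * rexp (-(h * x)) ^ n)
    (hlim : ∀ x, 0 < x →
      Tendsto (fun h => h * ∑' n, u h n * rexp (-(h * x)) ^ n) (𝓝[>] 0) (𝓝 (D x)))
    (hD : ∀ x, 0 < x → D x ≠ 0) (n : ℕ) {x δ : ℝ} (hx : 0 < x) (hδ : 0 < δ) :
    0 ≤ (-1) ^ n * (fwdDiff δ)^[n + 1] (fun y => (D y)⁻¹) x := by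
  refine ge_of_tendsto ((tendsto_fwdDiff_iter
    (fun y hy => (hlim y hy).inv₀ (hD y hy)) (n + 1) hx hδ).const_mul _) ?_
  filter_upwards [self_mem_nhdsWithin] with h (hh : 0 < h)
  obtain ⟨g, hg⟩ := exists_convolution_inverse (hu h hh 0).ne'
  have hinv : ∀ y, 0 < y → (h * ∑' m, u h m * rexp (-(h * y)) ^ m)⁻¹
      = h⁻¹ * ∑' m, g m * rexp (-(h * y)) ^ m := fun y hy => by
    rw [mul_inv, ← eq_inv_of_mul_eq_one_left (tsum_convolution_inverse_mul (hu h hh) (hlc h hh) hg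
      (Real.exp_pos _) (hs h hh y hy))]
  rw [fwdDiff_iter_congr hinv (n + 1) hx hδ, fwdDiff_iter_const_mul, mul_left_comm]
  exact mul_nonneg (inv_nonneg.2 hh.le) (fwdDiff_iter_tsum_convolution_inverse_nonneg hh
    (hu h hh) (hlc h hh) hg (hs h hh) n hx hδ)

lemma fwdDiff_iter_inv_div_nonneg (hu : ∀ h, 0 < h → ∀ n, 0 < u h n)
    (hlc : ∀ h, 0 < h → ∀ n, u h (n + 1) ^ 2 ≤ u h n * u h (n + 2))
    (hs : ∀ h, 0 < h → ∀ x, 0 < x → Summable fun n => u h n * rexp (-(h * x)) ^ n)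
    (hlim : ∀ x, 0 < x →
      Tendsto (fun h => h * ∑' n, u h n * rexp (-(h * x)) ^ n) (𝓝[>] 0) (𝓝 (D x)))
    (hD : ∀ x, 0 < x → D x ≠ 0) (n : ℕ) {x δ : ℝ} (hx : 0 < x) (hδ : 0 < δ) :
    0 ≤ (-1) ^ n * (fwdDiff δ)^[n] (fun y => (D y)⁻¹ * (1 / y)) x := by
  refine ge_of_tendsto ((tendsto_fwdDiff_iter (fun y hy => ((hlim y hy).inv₀ (hD y hy)).mul
    (tendsto_div_one_sub_exp_neg hy)) n hx hδ).const_mul _) ?_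
  filter_upwards [self_mem_nhdsWithin] with h (hh : 0 < h)
  obtain ⟨g, hg⟩ := exists_convolution_inverse (hu h hh 0).ne'
  have hsum : ∀ y, 0 < y → HasSum
      (fun m => (∑ k ∈ Finset.range (m + 1), g k) * rexp (-(h * y)) ^ m)
      ((h * ∑' m, u h m * rexp (-(h * y)) ^ m)⁻¹ * (h / (1 - rexp (-(h * y))))) := fun y hy => by
    convert hasSum_sum_range_mul_pow (Real.exp_pos (-(h * y)))
      (Real.exp_lt_one_iff.2 (neg_lt_zero.2 (mul_pos hh hy)))
      (summable_abs_convolution_inverse (hu h hh) (hlc h hh) hg (Real.exp_pos _) (hs h hh y hy))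
      using 1
    rw [mul_inv, ← eq_inv_of_mul_eq_one_left (tsum_convolution_inverse_mul (hu h hh) (hlc h hh) hg
      (Real.exp_pos _) (hs h hh y hy)), mul_comm h⁻¹, div_eq_mul_inv]
    field_simp
  rw [fwdDiff_iter_congr (fun y hy => (hsum y hy).tsum_eq.symm) n hx hδ]
  exact fwdDiff_iter_tsum_exp_nonneg hh
    (sum_range_convolution_inverse_nonneg (hu h hh) (hlc h hh) hg
      fun z hz hz1 => summable_mul_pow_of_summable_exp hh (hs h hh) hz hz1)
    (fun y hy => (hsum y hy).summable) n hx hδ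

end LogConvexKernel
section Digamma

open Filter Topology

lemma contDiffAt_Gamma_of_pos {x : ℝ} (hx : 0 < x) : ContDiffAt ℝ (⊤ : ℕ∞) Real.Gamma x := by
  have hopen : IsOpen {s : ℂ | 0 < s.re} := isOpen_lt continuous_const Complex.continuous_re
  have hd : DifferentiableOn ℂ Complex.Gamma {s : ℂ | 0 < s.re} := fun s (hs : 0 < s.re) =>
    (Complex.differentiableAt_Gamma s fun m hm => by
      rw [hm] at hs
      simp only [Complex.neg_re, Complex.natCast_re, Left.neg_pos_iff] at hs
      exact absurd hs (not_lt.2 m.cast_nonneg)).differentiableWithinAt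
  have hc : ContDiffAt ℂ (⊤ : ℕ∞) Complex.Gamma (x : ℂ) :=
    (hd.contDiffOn hopen).contDiffAt (hopen.mem_nhds (by simpa using hx))
  exact hc.real_of_complex

lemma contDiffOn_log_Gamma :
    ContDiffOn ℝ (⊤ : ℕ∞) (fun y : ℝ => Real.log (Real.Gamma y)) (Ioi 0) := fun _ hx =>
  ((contDiffAt_Gamma_of_pos hx).log (Real.Gamma_pos_of_pos hx).ne').contDiffWithinAt

lemma contDiffOn_digamma : ContDiffOn ℝ (⊤ : ℕ∞) digamma (Ioi 0) :=
  contDiffOn_log_Gamma.deriv_of_isOpen isOpen_Ioi (by simp)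

lemma differentiableAt_log_Gamma {x : ℝ} (hx : 0 < x) :
    DifferentiableAt ℝ (fun y : ℝ => Real.log (Real.Gamma y)) x :=
  (contDiffOn_log_Gamma.contDiffAt (Ioi_mem_nhds hx)).differentiableAt (by simp)

lemma monotoneOn_digamma : MonotoneOn digamma (Ioi 0) :=
  Real.convexOn_log_Gamma.monotoneOn_deriv fun _ hx => differentiableAt_log_Gamma hx

lemma digamma_add_one {x : ℝ} (hx : 0 < x) : digamma (x + 1) = digamma x + 1 / x := by
  have hev : (fun y : ℝ => Real.log (Real.Gamma (y + 1)))
      =ᶠ[𝓝 x] fun y => Real.log (Real.Gamma y) + Real.log y := by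
    filter_upwards [Ioi_mem_nhds hx] with y (hy : 0 < y)
    rw [Real.Gamma_add_one hy.ne', Real.log_mul hy.ne' (Real.Gamma_pos_of_pos hy).ne', add_comm]
  rw [digamma, ← deriv_comp_add_const, hev.deriv_eq,
    deriv_fun_add (differentiableAt_log_Gamma hx) (Real.differentiableAt_log hx.ne'),
    Real.deriv_log, one_div]

lemma digamma_add_nat_le {x : ℝ} (hx : 0 < x) (n : ℕ) :
    digamma (x + n) ≤ digamma x + n / x := by
  induction n with
  | zero => simp
  | succ n ih =>
    have h := digamma_add_one (x := x + n) (by positivity)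
    have : 1 / (x + n) ≤ 1 / x := one_div_le_one_div_of_le hx (by simp)
    push_cast
    rw [← add_assoc, h, add_div]
    linarith

lemma digamma_sub_digamma_nonneg {a b x : ℝ} (hb : 0 < b) (hab : b ≤ a) (hx : 0 < x) :
    0 ≤ digamma (x + a) - digamma (x + b) :=
  sub_nonneg.2 (monotoneOn_digamma (show 0 < x + b by positivity)
    (show 0 < x + a by linarith) (by linarith))

lemma digamma_sub_digamma_le {a b x : ℝ} (hb : 0 < b) (hab : b ≤ a) (hx : 0 < x) :
    digamma (x + a) - digamma (x + b) ≤ ⌈a - b⌉₊ / x := by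
  have h1 : digamma (x + a) ≤ digamma (x + b + ⌈a - b⌉₊) :=
    monotoneOn_digamma (show 0 < x + a by linarith) (show 0 < x + b + ⌈a - b⌉₊ by positivity)
      (by linarith [Nat.le_ceil (a - b)])
  have h2 := digamma_add_nat_le (x := x + b) (by positivity) ⌈a - b⌉₊
  have h3 : (⌈a - b⌉₊ : ℝ) / (x + b) ≤ ⌈a - b⌉₊ / x := by
    gcongr
    linarith
  linarith

lemma digamma_sub_digamma_sub_add_one {a b x : ℝ} (hb : 0 < b) (hab : b ≤ a) (hx : 0 < x) :
    digamma (x + a) - digamma (x + b) - (digamma (x + 1 + a) - digamma (x + 1 + b))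
      = 1 / (x + b) - 1 / (x + a) := by
  rw [add_right_comm x 1 a, add_right_comm x 1 b, digamma_add_one (by linarith),
    digamma_add_one (by linarith)]
  ring

lemma digamma_sub_digamma_pos {a b x : ℝ} (hb : 0 < b) (hab : b < a) (hx : 0 < x) :
    0 < digamma (x + a) - digamma (x + b) := by
  have h1 := digamma_sub_digamma_sub_add_one hb hab.le hx
  have h2 := digamma_sub_digamma_nonneg hb hab.le (x := x + 1) (by positivity)
  have h3 : 1 / (x + a) < 1 / (x + b) :=
    one_div_lt_one_div_of_lt (by positivity) (by linarith)
  linarith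

lemma tendsto_of_tendsto_sub_add_one {A : ℝ → ℝ → ℝ} {D : ℝ → ℝ} {c M : ℝ}
    (hA0 : ∀ h, 0 < h → ∀ x, 0 < x → 0 ≤ A h x)
    (hA : ∀ h, 0 < h → ∀ x, 0 < x → A h x ≤ c * (1 / x + h))
    (hD0 : ∀ x, 0 < x → 0 ≤ D x) (hD : ∀ x, 0 < x → D x ≤ M / x)
    (hlim : ∀ x, 0 < x → Tendsto (fun h => A h x - A h (x + 1)) (𝓝[>] 0) (𝓝 (D x - D (x + 1))))
    {x : ℝ} (hx : 0 < x) : Tendsto (fun h => A h x) (𝓝[>] 0) (𝓝 (D x)) := by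
  have hN : ∀ N : ℕ, Tendsto (fun h => A h x - A h (x + N)) (𝓝[>] 0) (𝓝 (D x - D (x + N))) := by
    intro N
    induction N with
    | zero => simp
    | succ N ih =>
      have := ih.add (hlim (x + N) (by positivity))
      simpa [← add_assoc] using this
  rw [Metric.tendsto_nhds]
  intro ε hε
  have hsmall : Tendsto (fun N : ℕ => (|c| + |M|) / (x + N)) atTop (𝓝 0) :=
    tendsto_const_nhds.div_atTop (tendsto_atTop_add_const_left _ x tendsto_natCast_atTop_atTop)
  obtain ⟨N, hNε⟩ := (hsmall.eventually (gt_mem_nhds (show 0 < ε / 3 by positivity))).exists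
  have hch : Tendsto (fun h : ℝ => |c| * h) (𝓝[>] 0) (𝓝 0) := by
    have : Tendsto (fun h : ℝ => |c| * h) (𝓝 0) (𝓝 (|c| * 0)) := Continuous.tendsto (by fun_prop) 0
    simpa using this.mono_left nhdsWithin_le_nhds
  filter_upwards [self_mem_nhdsWithin, Metric.tendsto_nhds.1 (hN N) (ε / 3) (by positivity),
    hch.eventually (gt_mem_nhds (show 0 < ε / 3 by positivity))] with h (hh : 0 < h) h1 h2
  rw [Real.dist_eq, abs_lt] at h1 ⊢
  have hxN : 0 < x + N := by positivity
  have h3 := hA0 h hh _ hxN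
  have h4 := hA h hh _ hxN
  have h5 := hD0 _ hxN
  have h6 := hD _ hxN
  have h7 : c * (1 / (x + N) + h) ≤ |c| / (x + N) + |c| * h := by
    calc c * (1 / (x + N) + h) ≤ |c| * (1 / (x + N) + h) := by gcongr; exact le_abs_self c
      _ = _ := by ring
  have h8 : M / (x + N) ≤ |M| / (x + N) := by gcongr; exact le_abs_self M
  have h9 : 0 ≤ |c| / (x + N) := by positivity
  have h10 : 0 ≤ |M| / (x + N) := by positivity
  rw [add_div] at hNε
  constructor <;> linarith [h1.1, h1.2]

end Digamma
section DigammaKernel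

open Filter Topology

lemma sinh_mul_cosh_le {c t : ℝ} (hc : 1 ≤ c) (ht : 0 ≤ t) :
    sinh (c * t) * cosh t ≤ c * cosh (c * t) * sinh t := by
  have hderiv : ∀ s, HasDerivAt (fun s => c * cosh (c * s) * sinh s - sinh (c * s) * cosh s)
      ((c ^ 2 - 1) * (sinh (c * s) * sinh s)) s := by
    intro s
    have hl : HasDerivAt (fun s => c * s) c s := by
      simpa using (hasDerivAt_id s).const_mul c
    refine (((hl.cosh.const_mul c).fun_mul (Real.hasDerivAt_sinh s)).fun_sub
      (hl.sinh.fun_mul (Real.hasDerivAt_cosh s))).congr_deriv ?_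
    ring
  have hmono : MonotoneOn (fun s => c * cosh (c * s) * sinh s - sinh (c * s) * cosh s) (Ici 0) := by
    refine monotoneOn_of_hasDerivWithinAt_nonneg (convex_Ici 0)
      (fun s _ => (hderiv s).continuousAt.continuousWithinAt)
      (fun s _ => (hderiv s).hasDerivWithinAt) fun s hs => ?_
    rw [interior_Ici] at hs
    have hs0 : 0 ≤ s := le_of_lt hs
    exact mul_nonneg (by nlinarith) (mul_nonneg
      (Real.sinh_nonneg_iff.2 (by positivity)) (Real.sinh_nonneg_iff.2 hs0))
  have := hmono (mem_Ici.2 le_rfl) (mem_Ici.2 ht) ht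
  simp only [mul_zero, Real.sinh_zero, zero_mul, sub_zero] at this
  linarith

lemma sinh_mul_sinh_le {c d y : ℝ} (hc : 1 ≤ c) (hd : 0 < d) (hdy : d ≤ y) :
    sinh (c * d) * sinh y ≤ sinh (c * y) * sinh d := by
  have hderiv : ∀ s ∈ Ioi (0 : ℝ), HasDerivAt (fun s => sinh (c * s) / sinh s)
      ((c * cosh (c * s) * sinh s - sinh (c * s) * cosh s) / sinh s ^ 2) s := by
    intro s hs
    have hl : HasDerivAt (fun s => c * s) c s := by
      simpa using (hasDerivAt_id s).const_mul c
    refine (hl.sinh.fun_div (Real.hasDerivAt_sinh s) (Real.sinh_pos_iff.2 hs).ne').congr_deriv ?_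
    ring
  have hmono : MonotoneOn (fun s => sinh (c * s) / sinh s) (Ioi 0) := by
    refine monotoneOn_of_hasDerivWithinAt_nonneg (convex_Ioi 0)
      (fun s hs => (hderiv s hs).continuousAt.continuousWithinAt)
      (fun s hs => (hderiv s (interior_subset hs)).hasDerivWithinAt) fun s hs => ?_
    have hs0 : 0 < s := interior_subset hs
    exact div_nonneg (sub_nonneg.2 (sinh_mul_cosh_le hc hs0.le)) (sq_nonneg _)
  have := hmono (mem_Ioi.2 hd) (mem_Ioi.2 (hd.trans_le hdy)) hdy
  simp only at this
  rwa [div_le_div_iff₀ (Real.sinh_pos_iff.2 hd) (Real.sinh_pos_iff.2 (hd.trans_le hdy))] at this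

lemma sinh_sub_mul_sinh_add (y d : ℝ) :
    sinh (y - d) * sinh (y + d) = sinh y ^ 2 - sinh d ^ 2 := by
  rw [Real.sinh_sub, Real.sinh_add]
  linear_combination sinh y ^ 2 * Real.cosh_sq d - sinh d ^ 2 * Real.cosh_sq y

/-- The function `t ↦ exp (-bt) (1 - exp (-ct)) / (1 - exp (-t))`, extended by continuity to `0`.
Its Laplace transform is `x ↦ ψ (x + b + c) - ψ (x + b)`. -/
noncomputable def digammaKernel (b c t : ℝ) : ℝ :=
  if t = 0 then c else rexp (-(b * t)) * (1 - rexp (-(c * t))) / (1 - rexp (-t))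

lemma digammaKernel_zero (b c : ℝ) : digammaKernel b c 0 = c := if_pos rfl

lemma digammaKernel_of_pos (b c : ℝ) {t : ℝ} (ht : 0 < t) : digammaKernel b c t
    = rexp (-((2 * b + c - 1) * (t / 2))) * (sinh (c * (t / 2)) / sinh (t / 2)) := by
  have h1 : 1 - rexp (-(c * t)) = 2 * rexp (-(c * (t / 2))) * sinh (c * (t / 2)) := by
    rw [Real.sinh_eq]
    have h2 : rexp (-(c * (t / 2))) * rexp (c * (t / 2)) = 1 := by
      rw [← Real.exp_add]; simp
    have h3 : rexp (-(c * (t / 2))) * rexp (-(c * (t / 2))) = rexp (-(c * t)) := by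
      rw [← Real.exp_add]; ring_nf
    linear_combination h3 - h2
  have h4 : 1 - rexp (-t) = 2 * rexp (-(t / 2)) * sinh (t / 2) := by
    rw [Real.sinh_eq]
    have h2 : rexp (-(t / 2)) * rexp (t / 2) = 1 := by rw [← Real.exp_add]; simp
    have h3 : rexp (-(t / 2)) * rexp (-(t / 2)) = rexp (-t) := by
      rw [← Real.exp_add]; ring_nf
    linear_combination h3 - h2
  have h5 : rexp (-(b * t)) * rexp (-(c * (t / 2)))
      = rexp (-((2 * b + c - 1) * (t / 2))) * rexp (-(t / 2)) := by
    rw [← Real.exp_add, ← Real.exp_add]; ring_nf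
  have hs : sinh (t / 2) ≠ 0 := (Real.sinh_pos_iff.2 (by positivity)).ne'
  rw [digammaKernel, if_neg ht.ne', h1, h4]
  rw [← mul_div_assoc (rexp (-((2 * b + c - 1) * (t / 2)))), div_eq_div_iff (mul_ne_zero (by positivity) hs) hs]
  linear_combination 2 * sinh (c * (t / 2)) * sinh (t / 2) * h5

lemma digammaKernel_pos (b : ℝ) {c t : ℝ} (hc : 0 < c) (ht : 0 ≤ t) : 0 < digammaKernel b c t := by
  rcases ht.eq_or_lt with rfl | ht
  · rwa [digammaKernel_zero]
  · rw [digammaKernel_of_pos b c ht]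
    exact mul_pos (Real.exp_pos _) (div_pos (Real.sinh_pos_iff.2 (by positivity))
      (Real.sinh_pos_iff.2 (by positivity)))

lemma digammaKernel_le {b c t : ℝ} (hb : 0 ≤ b) (hc : 1 ≤ c) (ht : 0 ≤ t) :
    digammaKernel b c t ≤ c := by
  rcases ht.eq_or_lt with rfl | ht
  · rw [digammaKernel_zero]
  · have h1 : 0 < 1 - rexp (-t) := sub_pos.2 (Real.exp_lt_one_iff.2 (neg_lt_zero.2 ht))
    have h2 : rexp (-(b * t)) ≤ 1 := Real.exp_le_one_iff.2 (by nlinarith)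
    have h3 := one_add_mul_self_le_rpow_one_add (s := rexp (-t) - 1)
      (by linarith [Real.exp_pos (-t)]) hc
    rw [add_sub_cancel, ← Real.exp_mul, show -t * c = -(c * t) by ring] at h3
    have h4 : 0 ≤ 1 - rexp (-(c * t)) := sub_nonneg.2 (Real.exp_le_one_iff.2 (by nlinarith))
    rw [digammaKernel, if_neg ht.ne', div_le_iff₀ h1]
    nlinarith

lemma digammaKernel_sq_le (b : ℝ) {c h : ℝ} (hc : 1 ≤ c) (hh : 0 < h) (n : ℕ) :
    digammaKernel b c ((n + 1 : ℕ) * h) ^ 2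
      ≤ digammaKernel b c (n * h) * digammaKernel b c ((n + 2 : ℕ) * h) := by
  have hc0 : 0 < c := one_pos.trans_le hc
  obtain ⟨d, hd, rfl⟩ : ∃ d, 0 < d ∧ h = 2 * d := ⟨h / 2, by positivity, by ring⟩
  rcases Nat.eq_zero_or_pos n with rfl | hn
  · rw [Nat.cast_zero, zero_mul, digammaKernel_zero, digammaKernel_of_pos b c (by positivity),
      digammaKernel_of_pos b c (by positivity)]
    have e1 : ((0 + 1 : ℕ) : ℝ) * (2 * d) / 2 = d := by push_cast; ring
    have e2 : ((0 + 2 : ℕ) : ℝ) * (2 * d) / 2 = 2 * d := by push_cast; ring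
    rw [e1, e2, mul_pow, ← Real.exp_nat_mul, mul_left_comm,
      show ((2 : ℕ) : ℝ) * -((2 * b + c - 1) * d) = -((2 * b + c - 1) * (2 * d)) by push_cast; ring]
    refine mul_le_mul_of_nonneg_left ?_ (Real.exp_pos _).le
    have hS : 0 < sinh d := Real.sinh_pos_iff.2 hd
    have hC : 0 < cosh d := Real.cosh_pos d
    have hSc : 0 < sinh (c * d) := Real.sinh_pos_iff.2 (by positivity)
    rw [mul_left_comm c 2 d, Real.sinh_two_mul, Real.sinh_two_mul, div_pow, mul_div_assoc',
      div_le_div_iff₀ (by positivity) (by positivity)]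
    have := mul_le_mul_of_nonneg_left (sinh_mul_cosh_le hc hd.le)
      (show 0 ≤ 2 * sinh (c * d) * sinh d by positivity)
    linarith
  · have hn' : (0 : ℝ) < n := Nat.cast_pos.2 hn
    set y : ℝ := (n + 1) * d with hy
    have hyd : 0 < y - d := by rw [hy]; ring_nf; positivity
    have hy0 : 0 < y := by positivity
    rw [digammaKernel_of_pos b c (by positivity), digammaKernel_of_pos b c (by positivity),
      digammaKernel_of_pos b c (by positivity)]
    have e0 : (n : ℝ) * (2 * d) / 2 = y - d := by rw [hy]; ring
    have e1 : ((n + 1 : ℕ) : ℝ) * (2 * d) / 2 = y := by rw [hy]; push_cast; ring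
    have e2 : ((n + 2 : ℕ) : ℝ) * (2 * d) / 2 = y + d := by rw [hy]; push_cast; ring
    rw [e0, e1, e2, mul_pow, ← Real.exp_nat_mul, mul_mul_mul_comm, ← Real.exp_add,
      show ((2 : ℕ) : ℝ) * -((2 * b + c - 1) * y)
        = -((2 * b + c - 1) * (y - d)) + -((2 * b + c - 1) * (y + d)) by push_cast; ring]
    refine mul_le_mul_of_nonneg_left ?_ (Real.exp_pos _).le
    have h1 : 0 < sinh (y - d) := Real.sinh_pos_iff.2 hyd
    have h2 : 0 < sinh (y + d) := Real.sinh_pos_iff.2 (by positivity)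
    have h3 : 0 < sinh y := Real.sinh_pos_iff.2 hy0
    rw [div_mul_div_comm, div_pow, div_le_div_iff₀ (by positivity) (by positivity), mul_sub,
      mul_add, sinh_sub_mul_sinh_add, sinh_sub_mul_sinh_add]
    have h4 := sinh_mul_sinh_le hc hd (show d ≤ y by linarith)
    have h5 : 0 < sinh (c * d) * sinh y :=
      mul_pos (Real.sinh_pos_iff.2 (by positivity)) h3
    have h6 := pow_le_pow_left₀ h5.le h4 2
    linarith [mul_pow (sinh (c * d)) (sinh y) 2, mul_pow (sinh (c * y)) (sinh d) 2]

variable {b c : ℝ}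

lemma hasSum_exp_neg_mul_pow {h s : ℝ} (hh : 0 < h) (hs : 0 < s) :
    HasSum (fun n => rexp (-(h * s)) ^ n) (1 - rexp (-(h * s)))⁻¹ :=
  hasSum_geometric_of_lt_one (Real.exp_pos _).le
    (Real.exp_lt_one_iff.2 (neg_lt_zero.2 (mul_pos hh hs)))

lemma summable_digammaKernel_mul (hb : 0 ≤ b) (hc : 1 ≤ c) {h x : ℝ} (hh : 0 < h) (hx : 0 < x) :
    Summable fun n : ℕ => digammaKernel b c (n * h) * rexp (-(h * x)) ^ n :=
  ((hasSum_exp_neg_mul_pow hh hx).summable.mul_left c).of_nonneg_of_le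
    (fun _ => mul_nonneg (digammaKernel_pos b (one_pos.trans_le hc) (by positivity)).le
      (by positivity))
    fun _ => mul_le_mul_of_nonneg_right (digammaKernel_le hb hc (by positivity)) (by positivity)

lemma mul_tsum_digammaKernel_le (hb : 0 ≤ b) (hc : 1 ≤ c) {h x : ℝ} (hh : 0 < h) (hx : 0 < x) :
    h * ∑' n : ℕ, digammaKernel b c (n * h) * rexp (-(h * x)) ^ n ≤ c * (1 / x + h) := by
  have hgeo := hasSum_exp_neg_mul_pow hh hx
  have hlt : 0 < 1 - rexp (-(h * x)) :=
    sub_pos.2 (Real.exp_lt_one_iff.2 (neg_lt_zero.2 (mul_pos hh hx)))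
  have h1 : ∑' n : ℕ, digammaKernel b c (n * h) * rexp (-(h * x)) ^ n
      ≤ c * (1 - rexp (-(h * x)))⁻¹ := by
    rw [← hgeo.tsum_eq, ← tsum_mul_left]
    exact (summable_digammaKernel_mul hb hc hh hx).tsum_le_tsum
      (fun n => mul_le_mul_of_nonneg_right (digammaKernel_le hb hc (by positivity)) (by positivity))
      (hgeo.summable.mul_left c)
  have h2 : h * (1 - rexp (-(h * x)))⁻¹ ≤ 1 / x + h := by
    have h3 : rexp (-(h * x)) * (1 + h * x) ≤ 1 := by
      have := mul_le_mul_of_nonneg_left (Real.add_one_le_exp (h * x)) (Real.exp_pos (-(h * x))).le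
      rw [← Real.exp_add, neg_add_cancel, Real.exp_zero] at this
      linarith
    rw [← div_eq_mul_inv, div_add' _ _ _ hx.ne', div_le_div_iff₀ hlt hx]
    linarith
  calc h * ∑' n : ℕ, digammaKernel b c (n * h) * rexp (-(h * x)) ^ n
      ≤ h * (c * (1 - rexp (-(h * x)))⁻¹) := by gcongr
    _ = c * (h * (1 - rexp (-(h * x)))⁻¹) := by ring
    _ ≤ c * (1 / x + h) := by gcongr

lemma mul_tsum_digammaKernel_sub (hb : 0 ≤ b) (hc : 1 ≤ c) {h x : ℝ} (hh : 0 < h) (hx : 0 < x) :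
    h * ∑' n : ℕ, digammaKernel b c (n * h) * rexp (-(h * x)) ^ n
      - h * ∑' n : ℕ, digammaKernel b c (n * h) * rexp (-(h * (x + 1))) ^ n
      = h / (1 - rexp (-(h * (x + b)))) - h / (1 - rexp (-(h * (x + (b + c))))) := by
  rw [← mul_sub, ← (summable_digammaKernel_mul hb hc hh hx).tsum_sub
    (summable_digammaKernel_mul hb hc hh (by positivity)), div_eq_mul_inv, div_eq_mul_inv,
    ← mul_sub, ← ((hasSum_exp_neg_mul_pow hh (s := x + b) (by positivity)).sub
      (hasSum_exp_neg_mul_pow hh (s := x + (b + c)) (by positivity))).tsum_eq]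
  congr 1
  refine tsum_congr fun n => ?_
  rcases Nat.eq_zero_or_pos n with rfl | hn
  · simp
  have ht : 0 < (n : ℝ) * h := by positivity
  have hne : 1 - rexp (-((n : ℝ) * h)) ≠ 0 :=
    (sub_pos.2 (Real.exp_lt_one_iff.2 (neg_lt_zero.2 ht))).ne'
  have e1 : rexp (-(h * (x + 1))) ^ n = rexp (-(h * x)) ^ n * rexp (-(n * h)) := by
    rw [← Real.exp_nat_mul, ← Real.exp_nat_mul, ← Real.exp_add]; ring_nf
  have e2 : rexp (-(h * (x + b))) ^ n = rexp (-(h * x)) ^ n * rexp (-(b * (n * h))) := by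
    rw [← Real.exp_nat_mul, ← Real.exp_nat_mul, ← Real.exp_add]; ring_nf
  have e3 : rexp (-(h * (x + (b + c)))) ^ n
      = rexp (-(h * x)) ^ n * rexp (-(b * (n * h))) * rexp (-(c * (n * h))) := by
    rw [← Real.exp_nat_mul, ← Real.exp_nat_mul, ← Real.exp_add, ← Real.exp_add]; ring_nf
  rw [e1, e2, e3, digammaKernel, if_neg ht.ne']
  field_simp

lemma tendsto_mul_tsum_digammaKernel (hb : 0 < b) (hc : 1 ≤ c) {x : ℝ} (hx : 0 < x) :
    Tendsto (fun h => h * ∑' n : ℕ, digammaKernel b c (n * h) * rexp (-(h * x)) ^ n) (𝓝[>] 0)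
      (𝓝 (digamma (x + (b + c)) - digamma (x + b))) := by
  have hbc : b ≤ b + c := by linarith
  refine tendsto_of_tendsto_sub_add_one
    (A := fun h x => h * ∑' n : ℕ, digammaKernel b c (n * h) * rexp (-(h * x)) ^ n)
    (D := fun x => digamma (x + (b + c)) - digamma (x + b)) (c := c) (M := ⌈b + c - b⌉₊)
    (fun h hh x _ => mul_nonneg hh.le (tsum_nonneg fun n => mul_nonneg
      (digammaKernel_pos b (one_pos.trans_le hc) (by positivity)).le (by positivity)))
    (fun h hh x hx => mul_tsum_digammaKernel_le hb.le hc hh hx)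
    (fun x hx => digamma_sub_digamma_nonneg hb hbc hx)
    (fun x hx => digamma_sub_digamma_le hb hbc hx) (fun x hx => ?_) hx
  rw [digamma_sub_digamma_sub_add_one hb hbc hx]
  refine ((tendsto_div_one_sub_exp_neg (s := x + b) (by positivity)).sub
    (tendsto_div_one_sub_exp_neg (s := x + (b + c)) (by positivity))).congr' ?_
  filter_upwards [self_mem_nhdsWithin] with h (hh : 0 < h)
  exact (mul_tsum_digammaKernel_sub hb.le hc hh hx).symm

end DigammaKernel

section Main

lemma contDiffOn_digamma_sub_inv {a b : ℝ} (hb : 0 < b) (hba : b < a) :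
    ContDiffOn ℝ (⊤ : ℕ∞) (fun x => (digamma (x + a) - digamma (x + b))⁻¹) (Ioi 0) :=
  ((contDiffOn_digamma.comp (by fun_prop) fun x (hx : 0 < x) => show 0 < x + a by linarith).sub
    (contDiffOn_digamma.comp (by fun_prop) fun x (hx : 0 < x) => show 0 < x + b by linarith)).inv
    fun _ hx => (digamma_sub_digamma_pos hb hba hx).ne'

lemma rpow_mul_deriv_F {a b x : ℝ} (hb : 0 < b) (hba : b < a) (hx : 0 < x) :
    x ^ (1 - (a - b)) * deriv (F a b) x
      = (a - b - 1) * ((digamma (x + a) - digamma (x + b))⁻¹ * (1 / x))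
        + deriv (fun x => (digamma (x + a) - digamma (x + b))⁻¹) x := by
  have hd : HasDerivAt (fun x => (digamma (x + a) - digamma (x + b))⁻¹)
      (deriv (fun x => (digamma (x + a) - digamma (x + b))⁻¹) x) x :=
    (((contDiffOn_digamma_sub_inv hb hba).contDiffAt (Ioi_mem_nhds hx)).differentiableAt
      (by simp)).hasDerivAt
  have hF : F a b = fun x => x ^ (a - b - 1) * (digamma (x + a) - digamma (x + b))⁻¹ := by
    funext x
    rw [F, div_eq_mul_inv]
  rw [hF, ((Real.hasDerivAt_rpow_const (Or.inl hx.ne')).fun_mul hd).deriv]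
  have h1 : x ^ (1 - (a - b)) * x ^ (a - b - 1) = 1 := by
    rw [← Real.rpow_add hx]; simp
  have h2 : x ^ (1 - (a - b)) * x ^ (a - b - 1 - 1) = 1 / x := by
    rw [← Real.rpow_add hx, one_div, ← Real.rpow_neg_one]
    ring_nf
  linear_combination deriv (fun x => (digamma (x + a) - digamma (x + b))⁻¹) x * h1
    + (a - b - 1) * (digamma (x + a) - digamma (x + b))⁻¹ * h2

end Main

theorem F_mem_genBernstein (a b : ℝ) (hb : 0 < b) (hba : b < a - 1) :
    CompletelyMonotonicOn (fun x => x ^ (1 - (a - b)) * deriv (F a b) x) := by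
  obtain ⟨c, rfl⟩ : ∃ c, a = b + c := ⟨a - b, by ring⟩
  have hc : 1 ≤ c := by linarith
  have hbc : b < b + c := by linarith
  set G : ℝ → ℝ := fun x => (digamma (x + (b + c)) - digamma (x + b))⁻¹ with hG
  have hGs : ContDiffOn ℝ (⊤ : ℕ∞) G (Ioi 0) := contDiffOn_digamma_sub_inv hb hbc
  have hG's : ContDiffOn ℝ (⊤ : ℕ∞) (deriv G) (Ioi 0) := hGs.deriv_of_isOpen isOpen_Ioi (by simp)
  have hQs : ContDiffOn ℝ (⊤ : ℕ∞) (fun x => G x * (1 / x)) (Ioi 0) :=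
    hGs.mul (contDiffOn_const.div contDiffOn_id fun _ hx => ne_of_gt hx)
  have heq : EqOn (fun x => x ^ (1 - (b + c - b)) * deriv (F (b + c) b) x)
      (fun x => (b + c - b - 1) * (G x * (1 / x)) + deriv G x) (Ioi 0) :=
    fun x hx => rpow_mul_deriv_F hb hbc hx
  refine ⟨((contDiffOn_const.mul hQs).add hG's).congr heq, fun n x hx => ?_⟩
  have hu : ∀ h : ℝ, 0 < h → ∀ n : ℕ, 0 < digammaKernel b c (n * h) := fun h hh n =>
    digammaKernel_pos b (one_pos.trans_le hc) (by positivity)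
  have hQ : 0 ≤ (-1) ^ n * iteratedDeriv n (fun x => G x * (1 / x)) x :=
    iteratedDeriv_nonneg_of_fwdDiff_iter hQs n hx fun δ hδ => fwdDiff_iter_inv_div_nonneg hu
      (fun h hh n => digammaKernel_sq_le b hc hh n)
      (fun h hh x hx => summable_digammaKernel_mul hb.le hc hh hx)
      (fun x hx => tendsto_mul_tsum_digammaKernel hb hc hx)
      (fun x hx => (digamma_sub_digamma_pos hb hbc hx).ne') n hx hδ
  have hG' : 0 ≤ (-1) ^ n * iteratedDeriv n (deriv G) x := by
    rw [← iteratedDeriv_succ']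
    exact iteratedDeriv_nonneg_of_fwdDiff_iter hGs (n + 1) hx fun δ hδ => fwdDiff_iter_inv_nonneg hu
      (fun h hh n => digammaKernel_sq_le b hc hh n)
      (fun h hh x hx => summable_digammaKernel_mul hb.le hc hh hx)
      (fun x hx => tendsto_mul_tsum_digammaKernel hb hc hx)
      (fun x hx => (digamma_sub_digamma_pos hb hbc hx).ne') n hx hδ
  have hQx := (hQs.contDiffAt (Ioi_mem_nhds hx)).of_le (m := n) (mod_cast le_top)
  rw [heq.iteratedDeriv_of_isOpen isOpen_Ioi n hx, iteratedDeriv_fun_add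
    (contDiffAt_const.mul hQx)
    ((hG's.contDiffAt (Ioi_mem_nhds hx)).of_le (mod_cast le_top)),
    iteratedDeriv_const_mul_field, mul_add, mul_left_comm]
  exact add_nonneg (mul_nonneg (by linarith) hQ) hG'
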